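/- arXiv:2511.16025 — 2 statements merged into one kernel-verified Lean document; each statement's English description precedes it below -/
import Mathlib

section
/- Define A(m) := ∑_{i=1}^{m-1} 2^{m-1-i}·(2^{-(2^i - 2)} - 2^{-(2^{i+1} - 2)}) + 2^{m-1} - (2^m - 1)·η for integers m ≥ 1. Then for all integers m₁ > m₂ ≥ 1, 2^{-(2^{m₁} - 1)} + 2^{-(2^{m₂} - 1)} - 2·2^{-(2^{m₁} + 2^{m₂} - 1)} ≥ 2η - A(m₁) - A(m₂). (This is the inequality ΔP ≥ 2η - α_{(2^{m₁}-1)} - α_{(2^{m₂}-1)} needed in Case 2 of the primal–dual analysis, allowing both dual α-values to be raised to η without increasing β.) -/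
open Finset

/-- `η := 1 - ∑_{i=1}^∞ 2^{-(2^i + i - 1)}` (reindexed by `i ↦ i + 1`, noting
`2^(i+1) + (i+1) - 1 = 2^(i+1) + i`). -/
noncomputable def eta : ℝ := 1 - ∑' i : ℕ, (1 / 2 : ℝ) ^ (2 ^ (i + 1) + i)

/-- `A m = α_{(2^m - 1)}`: the closed form
`∑_{i=1}^{m-1} 2^{m-1-i}·(2^{-(2^i-2)} - 2^{-(2^{i+1}-2)}) + 2^{m-1} - (2^m - 1)·η`
(note `2·(2^i - 2) + 2 = 2^{i+1} - 2`). -/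
noncomputable def A (m : ℕ) : ℝ :=
  (∑ i ∈ Finset.Icc 1 (m - 1),
      (2 : ℝ) ^ (m - 1 - i) *
        ((1 / 2 : ℝ) ^ (2 ^ i - 2) - (1 / 2 : ℝ) ^ (2 ^ (i + 1) - 2)))
    + 2 ^ (m - 1) - ((2 : ℝ) ^ m - 1) * eta

theorem summable_dyadic_tail (m : ℕ) :
    Summable fun i : ℕ => (1 / 2 : ℝ) ^ (2 ^ (m + i + 1) + i) := by
  refine Summable.of_nonneg_of_le (fun i => by positivity) (fun i => ?_) summable_geometric_two
  exact pow_le_pow_of_le_one (by norm_num) (by norm_num) (by lia)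

/-- The rescaled tail `∑ i, 2^{-(2^(m+i+1) + i)}` of the series defining `eta`. -/
noncomputable def dyadicTail (m : ℕ) : ℝ := ∑' i : ℕ, (1 / 2 : ℝ) ^ (2 ^ (m + i + 1) + i)

theorem dyadicTail_nonneg (m : ℕ) : 0 ≤ dyadicTail m :=
  tsum_nonneg fun _ => by positivity

theorem dyadicTail_eq (m : ℕ) :
    dyadicTail m = (1 / 2 : ℝ) ^ 2 ^ (m + 1) + dyadicTail (m + 1) / 2 := by
  rw [dyadicTail, (summable_dyadic_tail m).tsum_eq_zero_add, dyadicTail, ← tsum_div_const]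
  congr 1
  refine tsum_congr fun i => ?_
  rw [show m + (i + 1) + 1 = m + 1 + i + 1 by ring, ← add_assoc, pow_succ]
  ring

theorem eta_eq_one_sub_dyadicTail : eta = 1 - dyadicTail 0 := by
  simp [eta, dyadicTail]

theorem half_pow_sub_two (k : ℕ) :
    (1 / 2 : ℝ) ^ (2 ^ (k + 1) - 2) = 4 * (1 / 2 : ℝ) ^ 2 ^ (k + 1) := by
  obtain ⟨n, hn⟩ : ∃ n, 2 ^ (k + 1) = n + 2 :=
    Nat.exists_eq_add_of_le' (by have := Nat.one_le_two_pow (n := k); lia)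
  rw [hn, Nat.add_sub_cancel, pow_add]
  ring

theorem A_one : A 1 = 1 - eta := by
  norm_num [A]

theorem A_succ (k : ℕ) :
    A (k + 2) = 2 * A (k + 1)
      + (4 * (1 / 2 : ℝ) ^ 2 ^ (k + 1) - 4 * (1 / 2 : ℝ) ^ 2 ^ (k + 2)) - eta := by
  rw [A, A, show k + 2 - 1 = k + 1 by rfl, Nat.add_sub_cancel,
    Finset.sum_Icc_succ_top (by lia), Nat.sub_self, half_pow_sub_two, half_pow_sub_two (k + 1)]
  have h : ∀ f : ℕ → ℝ, ∑ i ∈ Finset.Icc 1 k, (2 : ℝ) ^ (k + 1 - i) * f i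
      = 2 * ∑ i ∈ Finset.Icc 1 k, (2 : ℝ) ^ (k - i) * f i := by
    intro f
    rw [Finset.mul_sum]
    refine Finset.sum_congr rfl fun i hi => ?_
    rw [Nat.succ_sub (Finset.mem_Icc.mp hi).2, pow_succ]
    ring
  rw [h fun i => (1 / 2 : ℝ) ^ (2 ^ i - 2) - (1 / 2 : ℝ) ^ (2 ^ (i + 1) - 2)]
  ring

theorem eta_sub_A (k : ℕ) :
    eta - A (k + 1) = 2 * (1 / 2 : ℝ) ^ 2 ^ (k + 1) - dyadicTail (k + 1) := by
  induction k with
  | zero =>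
    have h := dyadicTail_eq 0
    norm_num at h ⊢
    rw [A_one, eta_eq_one_sub_dyadicTail]
    linarith
  | succ k ih =>
    have h := dyadicTail_eq (k + 1)
    rw [A_succ]
    linarith

theorem eta_sub_A_le {m : ℕ} (hm : 1 ≤ m) :
    eta - A m ≤ 2 * (1 / 2 : ℝ) ^ 2 ^ m - ((1 / 2 : ℝ) ^ 2 ^ m) ^ 2 := by
  obtain ⟨k, rfl⟩ := Nat.exists_eq_add_of_le' hm
  have h := dyadicTail_eq (k + 1)
  rw [pow_succ 2 (k + 1), pow_mul] at h
  linarith [eta_sub_A k, dyadicTail_nonneg (k + 1 + 1)]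

theorem half_pow_sub_one {n : ℕ} (hn : 1 ≤ n) :
    (1 / 2 : ℝ) ^ (n - 1) = 2 * (1 / 2 : ℝ) ^ n := by
  obtain ⟨k, rfl⟩ := Nat.exists_eq_add_of_le' hn
  rw [Nat.add_sub_cancel, pow_succ]
  ring

/-- Case 2 inequality: for all `m₁ > m₂ ≥ 1`,
`ΔP = 2^{-(2^{m₁}-1)} + 2^{-(2^{m₂}-1)} - 2·2^{-(2^{m₁}+2^{m₂}-1)}
   ≥ 2η - A m₁ - A m₂`. -/
theorem case2_inequality :
    ∀ m₁ m₂ : ℕ, 1 ≤ m₂ → m₂ < m₁ →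
      2 * eta - A m₁ - A m₂ ≤
        (1 / 2 : ℝ) ^ (2 ^ m₁ - 1) + (1 / 2 : ℝ) ^ (2 ^ m₂ - 1)
          - 2 * (1 / 2 : ℝ) ^ (2 ^ m₁ + 2 ^ m₂ - 1) := by
  intro m₁ m₂ h₂ h₁
  have hp₁ := Nat.one_le_two_pow (n := m₁)
  rw [half_pow_sub_one hp₁, half_pow_sub_one Nat.one_le_two_pow,
    half_pow_sub_one (hp₁.trans (Nat.le_add_right _ _)), pow_add]
  have hA₁ := eta_sub_A_le (h₂.trans h₁.le)
  have hA₂ := eta_sub_A_le h₂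
  have hle : (1 / 2 : ℝ) ^ 2 ^ m₁ ≤ ((1 / 2 : ℝ) ^ 2 ^ m₂) ^ 2 := by
    rw [← pow_mul, ← pow_succ]
    exact pow_le_pow_of_le_one (by norm_num) (by norm_num) (Nat.pow_le_pow_right two_pos h₁)
  have hquarter : (1 / 2 : ℝ) ^ 2 ^ m₂ ≤ 1 / 4 :=
    (pow_le_pow_of_le_one (by norm_num) (by norm_num)
      (Nat.pow_le_pow_right two_pos h₂)).trans (by norm_num)
  have hpos : 0 ≤ (1 / 2 : ℝ) ^ 2 ^ m₂ := by positivity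
  generalize (1 / 2 : ℝ) ^ 2 ^ m₁ = x at *
  generalize (1 / 2 : ℝ) ^ 2 ^ m₂ = y at *
  have hxy : 4 * (x * y) ≤ y ^ 2 := by
    nlinarith [mul_le_mul_of_nonneg_right hle hpos,
      mul_le_mul_of_nonneg_left hquarter (sq_nonneg y)]
  linarith [sq_nonneg x]
end

section
/- Define A(m) := ∑_{i=1}^{m-1} 2^{m-1-i}·(2^{-(2^i - 2)} - 2^{-(2^{i+1} - 2)}) + 2^{m-1} - (2^m - 1)·η for integers m ≥ 1. Then A(m) ≤ η for every integer m ≥ 1; i.e., the dual values α_{(2^m - 1)} assigned by the primal–dual analysis never exceed η. -/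
open Finset

theorem half_pow_two_pow_sub_two (n : ℕ) :
    (1 / 2 : ℝ) ^ (2 ^ (n + 1) - 2) = 4 * 2 ^ n * (1 / 2 : ℝ) ^ (2 ^ (n + 1) + n) := by
  have h : 2 ≤ 2 ^ (n + 1) := by
    rw [pow_succ]
    have := Nat.one_le_two_pow (n := n)
    lia
  obtain ⟨k, hk⟩ := Nat.exists_eq_add_of_le h
  have h1 : (2 : ℝ) ^ n * (1 / 2 : ℝ) ^ n = 1 := by
    rw [← mul_pow]
    norm_num
  rw [hk, Nat.add_sub_cancel_left, pow_add, pow_add]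
  linear_combination (-(1 / 2 : ℝ) ^ k) * h1

theorem half_pow_two_pow_add_le (n k : ℕ) :
    (1 / 2 : ℝ) ^ (2 ^ (k + n + 1) + (k + n)) ≤
      (1 / 2 : ℝ) ^ (2 ^ (n + 1) + n) * (1 / 2) ^ k := by
  rw [← pow_add]
  apply pow_le_pow_of_le_one (by norm_num) (by norm_num)
  have : 2 ^ (n + 1) ≤ 2 ^ (k + n + 1) := Nat.pow_le_pow_right (by norm_num) (by lia)
  lia

theorem summable_half_pow_two_pow_add :
    Summable fun i : ℕ => (1 / 2 : ℝ) ^ (2 ^ (i + 1) + i) :=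
  Summable.of_nonneg_of_le (fun _ => by positivity)
    (fun k => by simpa only [add_zero] using half_pow_two_pow_add_le 0 k)
    (summable_geometric_two.mul_left _)

theorem tsum_half_pow_two_pow_add_le (n : ℕ) :
    ∑' k : ℕ, (1 / 2 : ℝ) ^ (2 ^ (k + n + 1) + (k + n)) ≤
      2 * (1 / 2 : ℝ) ^ (2 ^ (n + 1) + n) := by
  calc ∑' k : ℕ, (1 / 2 : ℝ) ^ (2 ^ (k + n + 1) + (k + n))
      ≤ ∑' k : ℕ, (1 / 2 : ℝ) ^ (2 ^ (n + 1) + n) * (1 / 2) ^ k :=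
        Summable.tsum_le_tsum (half_pow_two_pow_add_le n)
          ((summable_nat_add_iff (f := fun i : ℕ => (1 / 2 : ℝ) ^ (2 ^ (i + 1) + i)) n).2
            summable_half_pow_two_pow_add)
          (summable_geometric_two.mul_left _)
    _ = 2 * (1 / 2 : ℝ) ^ (2 ^ (n + 1) + n) := by
        rw [tsum_mul_left, tsum_geometric_two, mul_comm]

theorem sum_half_pow_sub_add_two_pow (n : ℕ) :
    (∑ i ∈ Finset.Icc 1 n, (2 : ℝ) ^ (n - i) *
        ((1 / 2 : ℝ) ^ (2 ^ i - 2) - (1 / 2 : ℝ) ^ (2 ^ (i + 1) - 2))) + 2 ^ n =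
      2 ^ (n + 1) * (1 - ∑ i ∈ Finset.range n, (1 / 2 : ℝ) ^ (2 ^ (i + 1) + i)
        - 2 * (1 / 2 : ℝ) ^ (2 ^ (n + 1) + n)) := by
  induction n with
  | zero => norm_num
  | succ n ih =>
    have h : ∑ i ∈ Finset.Icc 1 n, (2 : ℝ) ^ (n + 1 - i) *
          ((1 / 2 : ℝ) ^ (2 ^ i - 2) - (1 / 2 : ℝ) ^ (2 ^ (i + 1) - 2)) =
        2 * ∑ i ∈ Finset.Icc 1 n, (2 : ℝ) ^ (n - i) *
          ((1 / 2 : ℝ) ^ (2 ^ i - 2) - (1 / 2 : ℝ) ^ (2 ^ (i + 1) - 2)) := by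
      rw [Finset.mul_sum]
      refine Finset.sum_congr rfl fun i hi => ?_
      rw [Nat.succ_sub (Finset.mem_Icc.1 hi).2, pow_succ]
      ring
    rw [Finset.sum_Icc_succ_top (by lia), h, Finset.sum_range_succ, Nat.sub_self,
      half_pow_two_pow_sub_two n, half_pow_two_pow_sub_two (n + 1)]
    generalize (1 / 2 : ℝ) ^ (2 ^ (n + 1) + n) = x at *
    generalize (1 / 2 : ℝ) ^ (2 ^ (n + 1 + 1) + (n + 1)) = y at *
    linear_combination 2 * ih

/-- The dual values `α_{(2^m - 1)} = A m` never exceed `η`. -/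
theorem A_le_eta : ∀ m : ℕ, 1 ≤ m → A m ≤ eta := by
  intro m hm
  obtain ⟨n, rfl⟩ := Nat.exists_eq_add_of_le' hm
  have htail := tsum_half_pow_two_pow_add_le n
  have hsplit := summable_half_pow_two_pow_add.sum_add_tsum_nat_add n
  have hclosed := sum_half_pow_sub_add_two_pow n
  have hle : 1 - ∑ i ∈ Finset.range n, (1 / 2 : ℝ) ^ (2 ^ (i + 1) + i)
      - 2 * (1 / 2 : ℝ) ^ (2 ^ (n + 1) + n) ≤ eta := by
    rw [eta]
    linarith
  have hmul := mul_le_mul_of_nonneg_left hle (by positivity : (0 : ℝ) ≤ 2 ^ (n + 1))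
  rw [A, Nat.add_sub_cancel]
  linarith
end
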